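/- Let R ∈ ℝ and let u, v : ℝ → ℝ be continuously differentiable with compact support, and set η(x) = 2 φ(x) u(x) + u(x)² + v(x)². Then E(φ + u + i v) - E(φ) = ∫_{-∞}^R [ (u')² + (1 - 12φ² + 15φ⁴) u² + (v')² + (1 - 4φ² + 3φ⁴) v² + (3φ² - 2)(u² + v²)(4φu + u² + v²) + (2φu + u² + v²)³ ] dx + ∫_R^{∞} [ (u')² + (1 - 4φ² + 3φ⁴) u² + (v')² + (1 - 4φ² + 3φ⁴) v² + (3φ² - 2) η² + η³ ] dx. -/

import Mathlib

open Real MeasureTheory Set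

noncomputable def φ (x : ℝ) : ℝ := Real.sqrt ((1 + Real.tanh x) / 2)

/-- Energy density of the cubic–quintic NLS equation. -/
noncomputable def energyDensity (ψ : ℝ → ℂ) (x : ℝ) : ℝ :=
  ‖deriv ψ x‖ ^ 2 + ‖ψ x‖ ^ 2 * (1 - ‖ψ x‖ ^ 2) ^ 2

theorem phi_sq (x : ℝ) : φ x ^ 2 = (1 + Real.tanh x) / 2 := by
  unfold φ
  rw [Real.sq_sqrt]
  have := Real.neg_one_lt_tanh x
  linarith

theorem phi_pos (x : ℝ) : 0 < φ x := by
  unfold φ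
  apply Real.sqrt_pos.2
  have := Real.neg_one_lt_tanh x
  linarith

theorem hasDerivAt_tanh_aux (x : ℝ) : HasDerivAt Real.tanh (1 - Real.tanh x ^ 2) x := by
  have h := (Real.hasDerivAt_sinh x).div (Real.hasDerivAt_cosh x) (Real.cosh_pos x).ne'
  have e : Real.tanh = fun y => Real.sinh y / Real.cosh y := by
    funext y; exact Real.tanh_eq_sinh_div_cosh y
  have hc := (Real.cosh_pos x).ne'
  rw [e]
  refine HasDerivAt.congr_deriv h ?_
  show _ = 1 - (Real.sinh x / Real.cosh x) ^ 2
  field_simp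

theorem phi_deriv (x : ℝ) : HasDerivAt φ (φ x * (1 - φ x ^ 2)) x := by
  have hp := phi_pos x
  have hs := phi_sq x
  have h := (((hasDerivAt_tanh_aux x).const_add 1).div_const 2).sqrt
    (by rw [← hs]; positivity)
  have h2 : HasDerivAt φ ((1 - Real.tanh x ^ 2) / 2 / (2 * φ x)) x := h
  convert h2 using 1
  have ht : Real.tanh x = 2 * φ x ^ 2 - 1 := by linarith
  rw [ht]
  field_simp
  ring

theorem phi_cont : Continuous φ :=
  continuous_iff_continuousAt.2 fun x => (phi_deriv x).continuousAt

theorem base_density (x : ℝ) :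
    energyDensity (fun x => (φ x : ℂ)) x = 2 * φ x ^ 2 * (1 - φ x ^ 2) ^ 2 := by
  have h : HasDerivAt (fun x => (φ x : ℂ)) ((φ x * (1 - φ x ^ 2) : ℝ) : ℂ) x :=
    (phi_deriv x).ofReal_comp
  unfold energyDensity
  rw [h.deriv, Complex.norm_real, Complex.norm_real, Real.norm_eq_abs, Real.norm_eq_abs,
    sq_abs, sq_abs]
  ring

theorem base_integrable : Integrable (fun x => energyDensity (fun x => (φ x : ℂ)) x) := by
  simp_rw [base_density]
  refine (integrable_inv_one_add_sq).mono' ?_ ?_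
  · have := phi_cont
    exact Continuous.aestronglyMeasurable (by fun_prop)
  · refine Filter.Eventually.of_forall fun x => ?_
    have hs := phi_sq x
    have h1 := Real.neg_one_lt_tanh x
    have h2 := Real.tanh_lt_one x
    have hsinh : x ^ 2 ≤ Real.sinh x ^ 2 := by
      rw [sq_le_sq, Real.abs_sinh]
      exact Real.self_le_sinh_iff.2 (abs_nonneg x)
    have hc := Real.cosh_sq x
    have hcp := Real.cosh_pos x
    have ht : 1 - Real.tanh x ^ 2 = (Real.cosh x ^ 2)⁻¹ := by
      rw [Real.tanh_eq_sinh_div_cosh]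
      field_simp
      linarith
    rw [Real.norm_of_nonneg (by positivity)]
    calc 2 * φ x ^ 2 * (1 - φ x ^ 2) ^ 2 ≤ 1 - Real.tanh x ^ 2 := by
          rw [hs]
          nlinarith [mul_pos (by linarith : 0 < 1 + Real.tanh x) (by linarith : 0 < 1 - Real.tanh x)]
      _ = (Real.cosh x ^ 2)⁻¹ := ht
      _ ≤ (1 + x ^ 2)⁻¹ := by
          apply inv_anti₀ (by positivity)
          linarith

theorem pert_density (u v : ℝ → ℝ) (hu : ContDiff ℝ 1 u) (hv : ContDiff ℝ 1 v) (x : ℝ) :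
    energyDensity (fun x => (φ x : ℂ) + (u x : ℂ) + (v x : ℂ) * Complex.I) x =
    (φ x * (1 - φ x ^ 2) + deriv u x) ^ 2 + deriv v x ^ 2 +
      ((φ x + u x) ^ 2 + v x ^ 2) * (1 - ((φ x + u x) ^ 2 + v x ^ 2)) ^ 2 := by
  have hud : HasDerivAt u (deriv u x) x := (hu.differentiable one_ne_zero x).hasDerivAt
  have hvd : HasDerivAt v (deriv v x) x := (hv.differentiable one_ne_zero x).hasDerivAt
  have h : HasDerivAt (fun x => (φ x : ℂ) + (u x : ℂ) + (v x : ℂ) * Complex.I)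
      (((φ x * (1 - φ x ^ 2) : ℝ) : ℂ) + ((deriv u x : ℝ) : ℂ) + ((deriv v x : ℝ) : ℂ) * Complex.I) x :=
    ((phi_deriv x).ofReal_comp.add hud.ofReal_comp).add (hvd.ofReal_comp.mul_const Complex.I)
  have hn : ∀ a b c : ℝ, ‖(a : ℂ) + (b : ℂ) + (c : ℂ) * Complex.I‖ ^ 2 = (a + b) ^ 2 + c ^ 2 := by
    intro a b c
    rw [← Complex.normSq_eq_norm_sq, ← Complex.ofReal_add, Complex.normSq_add_mul_I]
  unfold energyDensity
  rw [h.deriv, hn, hn]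

theorem energy_expansion_split (R : ℝ) (u v : ℝ → ℝ)
    (hu : ContDiff ℝ 1 u) (hus : HasCompactSupport u)
    (hv : ContDiff ℝ 1 v) (hvs : HasCompactSupport v)
    (η : ℝ → ℝ) (hη : ∀ x, η x = 2 * φ x * u x + (u x) ^ 2 + (v x) ^ 2) :
    (∫ x : ℝ, energyDensity (fun x => (φ x : ℂ) + (u x : ℂ) + (v x : ℂ) * Complex.I) x) -
      (∫ x : ℝ, energyDensity (fun x => (φ x : ℂ)) x) =
    (∫ x in Iic R,
      ((deriv u x) ^ 2 + (1 - 12 * (φ x) ^ 2 + 15 * (φ x) ^ 4) * (u x) ^ 2 +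
        (deriv v x) ^ 2 + (1 - 4 * (φ x) ^ 2 + 3 * (φ x) ^ 4) * (v x) ^ 2 +
        (3 * (φ x) ^ 2 - 2) * ((u x) ^ 2 + (v x) ^ 2) *
          (4 * φ x * u x + (u x) ^ 2 + (v x) ^ 2) +
        (2 * φ x * u x + (u x) ^ 2 + (v x) ^ 2) ^ 3)) +
    (∫ x in Ioi R,
      ((deriv u x) ^ 2 + (1 - 4 * (φ x) ^ 2 + 3 * (φ x) ^ 4) * (u x) ^ 2 +
        (deriv v x) ^ 2 + (1 - 4 * (φ x) ^ 2 + 3 * (φ x) ^ 4) * (v x) ^ 2 +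
        (3 * (φ x) ^ 2 - 2) * (η x) ^ 2 + (η x) ^ 3)) := by
  have hφc := phi_cont
  have huc := hu.continuous
  have hvc := hv.continuous
  have hduc : Continuous (deriv u) := hu.continuous_deriv le_rfl
  have hdvc : Continuous (deriv v) := hv.continuous_deriv le_rfl
  have hηf : η = fun x => 2 * φ x * u x + (u x) ^ 2 + (v x) ^ 2 := funext hη
  -- the quadratic and higher part
  set P : ℝ → ℝ := fun x => (deriv u x) ^ 2 + (1 - 4 * (φ x) ^ 2 + 3 * (φ x) ^ 4) * (u x) ^ 2 +
        (deriv v x) ^ 2 + (1 - 4 * (φ x) ^ 2 + 3 * (φ x) ^ 4) * (v x) ^ 2 +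
        (3 * (φ x) ^ 2 - 2) * (η x) ^ 2 + (η x) ^ 3 with hP
  -- the linear part, a total derivative
  set L : ℝ → ℝ := fun x => 2 * ((φ x * (1 - φ x ^ 2)) * deriv u x +
    (φ x * (1 - φ x ^ 2)) * (1 - 3 * φ x ^ 2) * u x) with hL
  have hK : IsCompact (tsupport u ∪ tsupport v) := hus.isCompact.union hvs.isCompact
  have hzero : ∀ x, x ∉ tsupport u ∪ tsupport v →
      u x = 0 ∧ v x = 0 ∧ deriv u x = 0 ∧ deriv v x = 0 := by
    intro x hx
    rw [mem_union, not_or] at hx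
    exact ⟨image_eq_zero_of_notMem_tsupport hx.1, image_eq_zero_of_notMem_tsupport hx.2,
      Function.notMem_support.1 fun h => hx.1 (support_deriv_subset h),
      Function.notMem_support.1 fun h => hx.2 (support_deriv_subset h)⟩
  have hPi : Integrable P := by
    apply Continuous.integrable_of_hasCompactSupport
    · rw [hP, hηf]; fun_prop
    · refine HasCompactSupport.intro hK fun x hx => ?_
      obtain ⟨h1, h2, h3, h4⟩ := hzero x hx
      simp [hP, hη, h1, h2, h3, h4]
  have hLi : Integrable L := by
    apply Continuous.integrable_of_hasCompactSupport
    · rw [hL]; fun_prop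
    · refine HasCompactSupport.intro hK fun x hx => ?_
      obtain ⟨h1, h2, h3, h4⟩ := hzero x hx
      simp [hL, h1, h3]
  have hGi : Integrable (fun x => 2 * ((φ x * (1 - φ x ^ 2)) * u x)) := by
    apply Continuous.integrable_of_hasCompactSupport
    · fun_prop
    · refine HasCompactSupport.intro hK fun x hx => ?_
      obtain ⟨h1, h2, h3, h4⟩ := hzero x hx
      simp [h1]
  have hL0 : ∫ x, L x = 0 := by
    refine integral_eq_zero_of_hasDerivAt_of_integrable (fun x => ?_) hLi hGi
    have hud : HasDerivAt u (deriv u x) x := (hu.differentiable one_ne_zero x).hasDerivAt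
    have hp := phi_deriv x
    have h := ((hp.mul ((hp.pow 2).const_sub 1)).mul hud).const_mul 2
    refine h.congr_deriv ?_
    simp only [hL, Pi.mul_apply, Pi.pow_apply]
    push_cast
    ring
  have hE : (fun x => energyDensity (fun x => (φ x : ℂ) + (u x : ℂ) + (v x : ℂ) * Complex.I) x) =
      fun x => energyDensity (fun x => (φ x : ℂ)) x + (L x + P x) := by
    funext x
    rw [pert_density u v hu hv, base_density]
    simp only [hL, hP, hη]
    ring
  have hI : (∫ x in Iic R,
      ((deriv u x) ^ 2 + (1 - 12 * (φ x) ^ 2 + 15 * (φ x) ^ 4) * (u x) ^ 2 +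
        (deriv v x) ^ 2 + (1 - 4 * (φ x) ^ 2 + 3 * (φ x) ^ 4) * (v x) ^ 2 +
        (3 * (φ x) ^ 2 - 2) * ((u x) ^ 2 + (v x) ^ 2) *
          (4 * φ x * u x + (u x) ^ 2 + (v x) ^ 2) +
        (2 * φ x * u x + (u x) ^ 2 + (v x) ^ 2) ^ 3)) = ∫ x in Iic R, P x := by
    congr 1
    funext x
    simp only [hP, hη]
    ring
  have hLP : Integrable (fun x => L x + P x) := hLi.add hPi
  rw [hI, hE, integral_add base_integrable hLP, integral_add hLi hPi, hL0,
    intervalIntegral.integral_Iic_add_Ioi hPi.integrableOn hPi.integrableOn]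
  ring
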